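/- No word of the form u θ(u) u with u nonempty of length less than 7 and θ a morphic involution on {a,b,c} is a factor of any concatenation of six blocks from {aacb, accb} in which xxx, yyy, xyxyx, yxyxy (with x = aacb, y = accb) do not occur as block patterns. -/

import Mathlib

/-- If `u ++ v ++ u` is an infix of `w`, then `u` and `v` can be read off at an offset of `w`. -/
theorem exists_offset_of_isInfix_append {α : Type*} {u v w : List α}
    (hv : v.length = u.length) (h : (u ++ v ++ u) <:+: w) :
    ∃ i, i ≤ w.length ∧ ((w.drop i).take u.length = u ∧
      ((w.drop i).drop (u.length + u.length)).take u.length = u ∧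
      ((w.drop i).drop u.length).take u.length = v) := by
  obtain ⟨p, q, rfl⟩ := h
  refine ⟨p.length, by simp, by simp, ?_, ?_⟩
  · have h₁ : (p ++ (u ++ v ++ u) ++ q).drop p.length = (u ++ v) ++ (u ++ q) := by simp
    have h₂ : u.length + u.length = (u ++ v).length := by simp [hv]
    rw [h₁, h₂, List.drop_left, List.take_left]
  · have h₁ : (p ++ (u ++ v ++ u) ++ q).drop p.length = u ++ (v ++ (u ++ q)) := by simp
    rw [h₁, List.drop_left, ← hv, List.take_left]

/-- The concatenation of blocks `aacb` and `accb` described by `bs`. -/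
def blockWord (bs : List Bool) : List (Fin 3) :=
  (bs.map fun s => if s then ([0, 2, 2, 1] : List (Fin 3))
    else ([0, 0, 2, 1] : List (Fin 3))).flatten

/-- Boolean test: no factor `u θ(u) u` with `|u| = n` starts at the beginning of `v`. -/
def noPatternAt (v : List (Fin 3)) (n : ℕ) : Bool :=
  !((v.take n).length == n && (v.drop (n + n)).take n == v.take n &&
    decide (∃ p q r : Fin 3, (∀ z, ![p, q, r] (![p, q, r] z) = z) ∧
      (v.drop n).take n = (v.take n).map ![p, q, r]))

/-- Boolean test: `bs` contains a forbidden block pattern. -/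
def hasBlockPattern (bs : List Bool) : Bool :=
  [false, true].any fun s =>
    decide ([s, s, s] <:+: bs) || decide ([s, !s, s, !s, s] <:+: bs)

theorem noPatternAt_blockWord : ∀ b₁ b₂ b₃ b₄ b₅ b₆ : Bool,
    hasBlockPattern [b₁, b₂, b₃, b₄, b₅, b₆] = true ∨
      ∀ i < 25, ∀ n < 6,
        noPatternAt ((blockWord [b₁, b₂, b₃, b₄, b₅, b₆]).drop i) (n + 1) = true := by
  decide +kernel

/-- Letters: `a = 0`, `b = 1`, `c = 2` in `Fin 3`; blocks `x = aacb`
(encoded by `false`) and `y = accb` (encoded by `true`).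
For every concatenation `w'` of six blocks from `{x, y}` whose block sequence
avoids `ααα` (no three consecutive equal blocks) and `αβαβα` (no five
alternating blocks), no nonempty `u` with `|u| < 7` and no morphic involution
`θ` (induced by a letter involution `g`) make `u θ(u) u` a factor of `w'`. -/
theorem no_short_u_theta_u_u (bs : List Bool) (hlen : bs.length = 6)
    (hcube : ∀ s : Bool, ¬ [s, s, s] <:+: bs)
    (halt : ∀ s : Bool, ¬ [s, !s, s, !s, s] <:+: bs) :
    ∀ g : Fin 3 → Fin 3, (∀ z, g (g z) = z) →
      ∀ u : List (Fin 3), u ≠ [] → u.length < 7 →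
        ¬ (u ++ u.map g ++ u) <:+:
          (bs.map fun s => if s then ([0, 2, 2, 1] : List (Fin 3))
            else ([0, 0, 2, 1] : List (Fin 3))).flatten := by
  intro g hg u hu hu7 h
  change _ <:+: blockWord bs at h
  obtain ⟨i, hi, h₁, h₂, h₃⟩ := exists_offset_of_isInfix_append (by simp) h
  match bs, hlen with
  | [b₁, b₂, b₃, b₄, b₅, b₆], _ =>
    rcases noPatternAt_blockWord b₁ b₂ b₃ b₄ b₅ b₆ with hb | hb
    · obtain ⟨s, -, hs⟩ := List.any_eq_true.mp hb
      rcases Bool.or_eq_true_iff.mp hs with hs | hs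
      · exact hcube s (of_decide_eq_true hs)
      · exact halt s (of_decide_eq_true hs)
    · have hw : (blockWord [b₁, b₂, b₃, b₄, b₅, b₆]).length = 24 := by
        cases b₁ <;> cases b₂ <;> cases b₃ <;> cases b₄ <;> cases b₅ <;> cases b₆ <;> rfl
      have hpos := List.length_pos_iff.mpr hu
      have key := hb i (by omega) (u.length - 1) (by omega)
      rw [Nat.sub_add_cancel hpos] at key
      have hg' : ![g 0, g 1, g 2] = g := by
        ext z
        fin_cases z <;> rfl
      have hex : ∃ p q r : Fin 3, (∀ z, ![p, q, r] (![p, q, r] z) = z) ∧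
          u.map g = u.map ![p, q, r] :=
        ⟨g 0, g 1, g 2, by rwa [hg'], by rw [hg']⟩
      rw [noPatternAt, h₁, h₂, h₃, decide_eq_true hex] at key
      simp at key
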